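/- Periodic case without coercivity: Let H∈C(ℝⁿ) be convex with H(0)=0, and assume that for every nonzero ξ∈ℤⁿ, the function s↦H(sξ) is not affine on any interval (−δ,δ), δ>0. Let u₀∈C(ℝⁿ) be ℤⁿ-periodic. Then the viscosity solution u of u_t+H(∇_x u)=0, u(0,·)=u₀, satisfies u(t,·) ⇉ c uniformly on ℝⁿ as t→+∞, where c = min_x u₀(x). -/

import Mathlib

open Set Filter Topology RealInnerProductSpace MeasureTheory

noncomputable section

variable {E : Type*} [NormedAddCommGroup E] [InnerProductSpace ℝ E]

/-- The open half-space `Π = (0,∞) × ℝⁿ`. -/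
def PiDom (E : Type*) [NormedAddCommGroup E] [InnerProductSpace ℝ E] : Set (ℝ × E) :=
  Set.Ioi (0:ℝ) ×ˢ (Set.univ : Set E)

/-- Bounded uniformly continuous functions on `ℝⁿ`. -/
def IsBUC (u₀ : E → ℝ) : Prop :=
  UniformContinuous u₀ ∧ ∃ M : ℝ, ∀ x, |u₀ x| ≤ M

/-- `BUC_loc(Π̄)` : continuous on `Π̄ = [0,∞)×ℝⁿ`, bounded and uniformly continuous on
each layer `[0,T)×ℝⁿ`, `T>0`. -/
def IsBUCloc (u : ℝ × E → ℝ) : Prop :=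
  ContinuousOn u (Set.Ici (0:ℝ) ×ˢ (Set.univ : Set E)) ∧
  ∀ T : ℝ, 0 < T →
    (∃ M : ℝ, ∀ p ∈ Set.Ico (0:ℝ) T ×ˢ (Set.univ : Set E), |u p| ≤ M) ∧
    UniformContinuousOn u (Set.Ico (0:ℝ) T ×ˢ (Set.univ : Set E))

/-- The superdifferential `D⁺u(t₀,x₀)`: pairs `(s,v) = ∇φ(t₀,x₀)` over all `C¹` functions `φ`
such that `(t₀,x₀)` is a point of local maximum of `u - φ` in `Π`. -/
def superdiff (u : ℝ × E → ℝ) (p : ℝ × E) : Set (ℝ × E) :=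
  {sv | ∃ φ : ℝ × E → ℝ, ContDiff ℝ 1 φ ∧
    IsLocalMaxOn (fun q => u q - φ q) (PiDom E) p ∧
    fderiv ℝ φ p (1, 0) = sv.1 ∧ ∀ w : E, fderiv ℝ φ p (0, w) = ⟪sv.2, w⟫}

/-- The subdifferential `D⁻u(t₀,x₀)`. -/
def subdiff (u : ℝ × E → ℝ) (p : ℝ × E) : Set (ℝ × E) :=
  {sv | ∃ φ : ℝ × E → ℝ, ContDiff ℝ 1 φ ∧
    IsLocalMinOn (fun q => u q - φ q) (PiDom E) p ∧
    fderiv ℝ φ p (1, 0) = sv.1 ∧ ∀ w : E, fderiv ℝ φ p (0, w) = ⟪sv.2, w⟫}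

/-- Viscosity subsolution of `u_t + H(∇ₓu) = 0`, `u(0,·) = u₀`. -/
def IsViscSubsol (H : E → ℝ) (u₀ : E → ℝ) (u : ℝ × E → ℝ) : Prop :=
  IsBUCloc u ∧ (∀ x, u (0, x) ≤ u₀ x) ∧
  ∀ p ∈ PiDom E, ∀ sv ∈ superdiff u p, sv.1 + H sv.2 ≤ 0

/-- Viscosity supersolution of `u_t + H(∇ₓu) = 0`, `u(0,·) = u₀`. -/
def IsViscSupersol (H : E → ℝ) (u₀ : E → ℝ) (u : ℝ × E → ℝ) : Prop :=
  IsBUCloc u ∧ (∀ x, u₀ x ≤ u (0, x)) ∧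
  ∀ p ∈ PiDom E, ∀ sv ∈ subdiff u p, 0 ≤ sv.1 + H sv.2

/-- Viscosity solution of `u_t + H(∇ₓu) = 0`, `u(0,·) = u₀`. -/
def IsViscSol (H : E → ℝ) (u₀ : E → ℝ) (u : ℝ × E → ℝ) : Prop :=
  IsViscSubsol H u₀ u ∧ IsViscSupersol H u₀ u

/-- The projection of `ℝⁿ` onto the torus `ℝⁿ / ℤⁿ`. -/
def torusProj {n : ℕ} (x : EuclideanSpace ℝ (Fin n)) : UnitAddTorus (Fin n) :=
  fun i => (x i : UnitAddCircle)

theorem isOpenQuotientMap_torusProj (n : ℕ) :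
    IsOpenQuotientMap (torusProj : EuclideanSpace ℝ (Fin n) → UnitAddTorus (Fin n)) := by
  have h : IsOpenQuotientMap
      (Pi.map fun _ : Fin n => ((↑) : ℝ → UnitAddCircle)) :=
    IsOpenQuotientMap.piMap fun _ => QuotientAddGroup.isOpenQuotientMap_mk
  exact h.comp (EuclideanSpace.equiv (Fin n) ℝ).toHomeomorph.isOpenQuotientMap

/-- A continuous `ℤⁿ`-periodic function descends to the torus. -/
theorem exists_torus_lift {n : ℕ} {f : EuclideanSpace ℝ (Fin n) → ℝ} (hf : Continuous f)
    (hper : ∀ x : EuclideanSpace ℝ (Fin n), ∀ e : Fin n → ℤ,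
      f (x + (EuclideanSpace.equiv (Fin n) ℝ).symm (fun i => (e i : ℝ))) = f x) :
    ∃ g : C(UnitAddTorus (Fin n), ℝ), ∀ x, g (torusProj x) = f x := by
  have hq : IsQuotientMap
      (⟨torusProj, (isOpenQuotientMap_torusProj n).continuous⟩ : C(_, UnitAddTorus (Fin n))) :=
    (isOpenQuotientMap_torusProj n).isQuotientMap
  have hfac : Function.FactorsThrough (⟨f, hf⟩ : C(EuclideanSpace ℝ (Fin n), ℝ))
      (⟨torusProj, (isOpenQuotientMap_torusProj n).continuous⟩ : C(_, UnitAddTorus (Fin n))) := by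
    intro x y hxy
    have h : ∀ i, ∃ k : ℤ, y i = x i + k := by
      intro i
      have hi : (x i : UnitAddCircle) = y i := congrFun hxy i
      have h0 : ((y i - x i : ℝ) : UnitAddCircle) = 0 := by rw [AddCircle.coe_sub, hi, sub_self]
      obtain ⟨k, hk⟩ := AddCircle.coe_eq_zero_iff 1 |>.1 h0
      refine ⟨k, ?_⟩
      rw [zsmul_one] at hk
      linarith
    choose e he using h
    have : y = x + (EuclideanSpace.equiv (Fin n) ℝ).symm (fun i => (e i : ℝ)) := by
      ext i
      simp [he]
    simp only [ContinuousMap.coe_mk]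
    rw [this, hper]
  exact ⟨hq.lift ⟨f, hf⟩ hfac,
    fun x => congrArg (fun F : C(_, ℝ) => F x) (hq.lift_comp ⟨f, hf⟩ hfac)⟩

theorem mFourier_torusProj {n : ℕ} (ξ : Fin n → ℤ) (x : EuclideanSpace ℝ (Fin n)) :
    UnitAddTorus.mFourier ξ (torusProj x) =
      Complex.exp (2 * Real.pi * Complex.I * ((∑ i, ξ i * x i : ℝ) : ℂ)) := by
  simp only [UnitAddTorus.mFourier, ContinuousMap.coe_mk, torusProj, fourier_coe_apply]
  rw [← Complex.exp_sum]
  congr 1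
  push_cast
  rw [Finset.mul_sum]
  refine Finset.sum_congr rfl fun i _ => ?_
  ring

theorem norm_integral_exp_le {θ : ℝ} (hθ : θ ≠ 0) :
    ‖∫ s in Icc (0 : ℝ) 1, Complex.exp (2 * Real.pi * Complex.I * ((-(s * θ) : ℝ) : ℂ))‖
      ≤ 1 / |θ| := by
  have hpi : (Real.pi : ℂ) ≠ 0 := by exact_mod_cast Real.pi_ne_zero
  have hc : -(2 * Real.pi * Complex.I * (θ : ℂ)) ≠ 0 := by
    simp [hpi, hθ]
  have h1 : ∫ s in Icc (0 : ℝ) 1, Complex.exp (2 * Real.pi * Complex.I * ((-(s * θ) : ℝ) : ℂ))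
      = ∫ s in (0 : ℝ)..1, Complex.exp (-(2 * Real.pi * Complex.I * (θ : ℂ)) * s) := by
    rw [intervalIntegral.integral_of_le zero_le_one, integral_Icc_eq_integral_Ioc]
    refine integral_congr_ae (Eventually.of_forall fun s => ?_)
    simp only
    congr 1
    push_cast
    ring
  rw [h1, integral_exp_mul_complex hc, norm_div]
  have h2 : ‖-(2 * Real.pi * Complex.I * (θ : ℂ))‖ = 2 * Real.pi * |θ| := by
    simp [abs_of_pos Real.pi_pos]
  have h3 : ‖Complex.exp (-(2 * Real.pi * Complex.I * (θ : ℂ)) * ((1 : ℝ) : ℂ)) -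
      Complex.exp (-(2 * Real.pi * Complex.I * (θ : ℂ)) * ((0 : ℝ) : ℂ))‖ ≤ 2 := by
    refine (norm_sub_le _ _).trans ?_
    have : -(2 * Real.pi * Complex.I * (θ : ℂ)) * ((1 : ℝ) : ℂ) =
        ((-(2 * Real.pi * θ) : ℝ) : ℂ) * Complex.I := by push_cast; ring
    rw [this, Complex.norm_exp_ofReal_mul_I]
    norm_num
  rw [h2]
  have hθ' : 0 < |θ| := abs_pos.2 hθ
  rw [div_le_div_iff₀ (by positivity) hθ']
  nlinarith [Real.pi_gt_three]

theorem norm_integral_mFourier_le {n : ℕ} {ι : Type*} [Fintype ι] (ξ : Fin n → ℤ)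
    (b : ι → EuclideanSpace ℝ (Fin n)) (x : EuclideanSpace ℝ (Fin n)) (j : ι)
    (hj : ∑ i, ξ i * b j i ≠ 0) :
    ‖∫ s, UnitAddTorus.mFourier ξ (torusProj (x - ∑ k, s k • b k))
        ∂(Measure.pi fun _ : ι => volume.restrict (Icc (0 : ℝ) 1))‖
      ≤ 1 / |∑ i, ξ i * b j i| := by
  classical
  have h1 : ∀ s : ι → ℝ, UnitAddTorus.mFourier ξ (torusProj (x - ∑ k, s k • b k)) =
      Complex.exp (2 * Real.pi * Complex.I * ((∑ i, ξ i * x i : ℝ) : ℂ)) *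
      ∏ k, Complex.exp (2 * Real.pi * Complex.I * ((-(s k * ∑ i, ξ i * b k i) : ℝ) : ℂ)) := by
    intro s
    rw [mFourier_torusProj, ← Complex.exp_sum, ← Complex.exp_add, ← Finset.mul_sum, ← mul_add,
      ← Complex.ofReal_sum, ← Complex.ofReal_add]
    congr 3
    simp only [PiLp.sub_apply, WithLp.ofLp_sum, Finset.sum_apply, PiLp.smul_apply, smul_eq_mul,
      mul_sub, Finset.sum_sub_distrib, Finset.sum_neg_distrib, Finset.mul_sum]
    rw [Finset.sum_comm, sub_eq_add_neg]
    congr 2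
    refine Finset.sum_congr rfl fun k _ => Finset.sum_congr rfl fun i _ => ?_
    ring
  simp_rw [h1]
  rw [integral_const_mul, norm_mul]
  have h2 : ‖Complex.exp (2 * Real.pi * Complex.I * ((∑ i, ξ i * x i : ℝ) : ℂ))‖ = 1 := by
    rw [show 2 * Real.pi * Complex.I * ((∑ i, ξ i * x i : ℝ) : ℂ) =
      ((2 * Real.pi * ∑ i, ξ i * x i : ℝ) : ℂ) * Complex.I by push_cast; ring]
    exact Complex.norm_exp_ofReal_mul_I _
  rw [h2, one_mul, integral_fintype_prod_eq_prod (fun k (r : ℝ) =>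
    Complex.exp (2 * Real.pi * Complex.I * ((-(r * ∑ i, ξ i * b k i) : ℝ) : ℂ))), norm_prod,
    ← Finset.mul_prod_erase _ _ (Finset.mem_univ j)]
  refine (mul_le_of_le_one_right (norm_nonneg _) ?_).trans (norm_integral_exp_le hj)
  refine Finset.prod_le_one (fun _ _ => norm_nonneg _) fun k _ => ?_
  refine (norm_setIntegral_le_of_norm_le_const (C := 1) (by simp) fun r _ => ?_).trans (by simp)
  rw [show 2 * Real.pi * Complex.I * ((-(r * ∑ i, ξ i * b k i) : ℝ) : ℂ) =
    ((2 * Real.pi * -(r * ∑ i, ξ i * b k i) : ℝ) : ℂ) * Complex.I by push_cast; ring]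
  exact (Complex.norm_exp_ofReal_mul_I _).le

theorem integral_mFourier_eq_zero {n : ℕ} {ξ : Fin n → ℤ} (hξ : ξ ≠ 0) :
    ∫ y, UnitAddTorus.mFourier ξ y
      ∂(Measure.pi fun _ : Fin n => (AddCircle.haarAddCircle : Measure UnitAddCircle)) = 0 := by
  obtain ⟨i, hi⟩ := Function.ne_iff.mp hξ
  simp only [UnitAddTorus.mFourier, ContinuousMap.coe_mk]
  rw [integral_fintype_prod_eq_prod (fun i (y : UnitAddCircle) => fourier (ξ i) y)]
  refine Finset.prod_eq_zero (Finset.mem_univ i) ?_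
  exact integral_eq_zero_of_add_right_eq_neg (fourier_add_half_inv_index hi one_pos)

/-- If a family of vectors has, for each frequency in a suitable finite set, a member whose
pairing with that frequency is large, then the box it spans, translated arbitrarily, meets the
support of a given nonzero nonnegative function on the torus. -/
theorem exists_pos_on_box {n : ℕ} (g : C(UnitAddTorus (Fin n), ℝ)) (hg : 0 ≤ g)
    {y₀ : UnitAddTorus (Fin n)} (hy₀ : g y₀ ≠ 0) :
    ∃ (S : Finset (Fin n → ℤ)) (R : ℝ), 0 ∉ S ∧
      ∀ b : S → EuclideanSpace ℝ (Fin n), (∀ ξ : S, R ≤ |∑ i, ξ.1 i * b ξ i|) →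
        ∀ x : EuclideanSpace ℝ (Fin n), ∃ s : S → ℝ, (∀ ξ, s ξ ∈ Icc (0 : ℝ) 1) ∧
          0 < g (torusProj (x - ∑ ξ, s ξ • b ξ)) := by
  classical
  set μ : Measure (UnitAddTorus (Fin n)) :=
    Measure.pi fun _ : Fin n => (AddCircle.haarAddCircle : Measure UnitAddCircle) with hμ
  set m := ∫ y, g y ∂μ with hm
  have hmpos : 0 < m := g.continuous.integral_pos_of_hasCompactSupport_nonneg_nonzero
    (HasCompactSupport.of_compactSpace _) hg hy₀
  let gc : C(UnitAddTorus (Fin n), ℂ) := ⟨fun y => (g y : ℂ), by fun_prop⟩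
  have hcl : gc ∈ closure
      (Submodule.span ℂ (range (UnitAddTorus.mFourier (d := Fin n))) : Set C(_, ℂ)) := by
    rw [← Submodule.topologicalClosure_coe, UnitAddTorus.span_mFourier_closure_eq_top]
    trivial
  obtain ⟨p, hp, hgp⟩ := Metric.mem_closure_iff.1 hcl (m / 4) (by positivity)
  obtain ⟨c, rfl⟩ := Finsupp.mem_span_range_iff_exists_finsupp.1 hp
  set p := c.sum fun i a => a • UnitAddTorus.mFourier (d := Fin n) i with hpdef
  have hclose : ∀ y, ‖(g y : ℂ) - p y‖ ≤ m / 4 := fun y => by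
    have := (ContinuousMap.dist_apply_le_dist (f := gc) (g := p) y).trans hgp.le
    rwa [dist_eq_norm] at this
  have hpy : ∀ y, p y = c 0 + ∑ ξ ∈ c.support.erase 0, c ξ * UnitAddTorus.mFourier ξ y := by
    intro y
    have : p y = ∑ ξ ∈ c.support, c ξ * UnitAddTorus.mFourier ξ y := by
      simp [hpdef, Finsupp.sum, ContinuousMap.sum_apply]
    rw [this]
    by_cases h0 : (0 : Fin n → ℤ) ∈ c.support
    · rw [← Finset.add_sum_erase _ _ h0, UnitAddTorus.mFourier_zero]
      simp
    · rw [Finset.erase_eq_of_notMem h0, Finsupp.notMem_support_iff.1 h0, zero_add]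
  have hint : ∀ f : C(UnitAddTorus (Fin n), ℂ), Integrable (fun y => f y) μ := fun f =>
    f.continuous.integrable_of_hasCompactSupport (HasCompactSupport.of_compactSpace _)
  have hpint : ∫ y, p y ∂μ = c 0 := by
    simp_rw [hpy]
    rw [integral_add (integrable_const _)
      (integrable_finsetSum _ fun ξ _ => (hint _).const_mul _),
      integral_finsetSum _ fun ξ _ => (hint _).const_mul _]
    rw [Finset.sum_eq_zero fun ξ hξ => ?_]
    · simp
    · rw [integral_const_mul, integral_mFourier_eq_zero (Finset.ne_of_mem_erase hξ), mul_zero]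
  have hc0 : ‖(m : ℂ) - c 0‖ ≤ m / 4 := by
    have h1 : (m : ℂ) - c 0 = ∫ y, ((g y : ℂ) - p y) ∂μ := by
      refine Eq.trans ?_ (integral_sub (hint gc) (hint p)).symm
      rw [hpint, hm]
      congr 1
      exact integral_ofReal.symm
    rw [h1]
    refine (norm_integral_le_of_norm_le_const (Eventually.of_forall hclose)).trans ?_
    simp
  set C := ∑ ξ ∈ c.support.erase 0, ‖c ξ‖ with hC
  have hC0 : 0 ≤ C := Finset.sum_nonneg fun _ _ => norm_nonneg _
  refine ⟨c.support.erase 0, 4 * (C + 1) / m, by simp, fun b hb x => ?_⟩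
  by_contra! hcon
  set ν : Measure (c.support.erase 0 → ℝ) :=
    Measure.pi fun _ => volume.restrict (Icc (0 : ℝ) 1) with hν
  have hprob : IsProbabilityMeasure (volume.restrict (Icc (0 : ℝ) 1)) := ⟨by simp⟩
  have hνs : ∀ᵐ s ∂ν, ∀ ξ, s ξ ∈ Icc (0 : ℝ) 1 := by
    rw [hν, ae_all_iff]
    intro ξ
    exact (Measure.quasiMeasurePreserving_eval _ ξ).ae (ae_restrict_mem measurableSet_Icc)
  have hcont : Continuous fun s : c.support.erase 0 → ℝ =>
      torusProj (x - ∑ ξ, s ξ • b ξ) :=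
    (isOpenQuotientMap_torusProj n).continuous.comp (by fun_prop)
  have hintν : ∀ f : C(UnitAddTorus (Fin n), ℂ),
      Integrable (fun s => f (torusProj (x - ∑ ξ, s ξ • b ξ))) ν := fun f =>
    Integrable.of_bound (f.continuous.comp hcont).aestronglyMeasurable ‖f‖
      (Eventually.of_forall fun s => f.norm_coe_le_norm _)
  have hpν : ∫ s, p (torusProj (x - ∑ ξ, s ξ • b ξ)) ∂ν = c 0 + ∑ ξ ∈ c.support.erase 0,
      c ξ * ∫ s, UnitAddTorus.mFourier ξ (torusProj (x - ∑ ξ, s ξ • b ξ)) ∂ν := by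
    simp_rw [hpy]
    rw [integral_add (integrable_const _)
      (integrable_finsetSum _ fun ξ _ => (hintν _).const_mul _),
      integral_finsetSum _ fun ξ _ => (hintν _).const_mul _]
    simp [integral_const_mul]
  have hsmall : ‖∫ s, p (torusProj (x - ∑ ξ, s ξ • b ξ)) ∂ν‖ ≤ m / 4 := by
    refine (norm_integral_le_of_norm_le_const (C := m / 4) ?_).trans (by simp)
    filter_upwards [hνs] with s hs
    have h0 : g (torusProj (x - ∑ ξ, s ξ • b ξ)) = 0 := le_antisymm (hcon s hs) (hg _)
    have := hclose (torusProj (x - ∑ ξ, s ξ • b ξ))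
    rwa [h0, Complex.ofReal_zero, zero_sub, norm_neg] at this
  have hsum : ‖∑ ξ ∈ c.support.erase 0,
      c ξ * ∫ s, UnitAddTorus.mFourier ξ (torusProj (x - ∑ ξ, s ξ • b ξ)) ∂ν‖ ≤ m / 4 := by
    calc _ ≤ ∑ ξ ∈ c.support.erase 0, ‖c ξ‖ * (m / (4 * (C + 1))) := by
          refine norm_sum_le_of_le _ fun ξ hξ => ?_
          rw [norm_mul]
          refine mul_le_mul_of_nonneg_left ?_ (norm_nonneg _)
          have hR : 0 < 4 * (C + 1) / m := by positivity
          have hbξ := hb ⟨ξ, hξ⟩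
          refine (norm_integral_mFourier_le ξ b x ⟨ξ, hξ⟩
            (abs_pos.1 (hR.trans_le hbξ))).trans ?_
          rw [← one_div_div (4 * (C + 1)) m]
          exact one_div_le_one_div_of_le hR hbξ
      _ = C * (m / (4 * (C + 1))) := by rw [← Finset.sum_mul]
      _ ≤ m / 4 := by
          rw [← mul_div_assoc, div_le_div_iff₀ (by positivity) (by norm_num)]
          nlinarith
  have hfin : ‖(m : ℂ)‖ ≤ m / 4 + m / 4 + m / 4 := by
    rw [hpν] at hsmall
    set Z := ∑ ξ ∈ c.support.erase 0,
      c ξ * ∫ s, UnitAddTorus.mFourier ξ (torusProj (x - ∑ ξ, s ξ • b ξ)) ∂ν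
    calc ‖(m : ℂ)‖ = ‖((m : ℂ) - c 0) + (c 0 + Z) - Z‖ := by congr 1; ring
      _ ≤ _ := (norm_sub_le _ _).trans (add_le_add ((norm_add_le _ _).trans
          (add_le_add hc0 hsmall)) hsum)
  rw [Complex.norm_real, Real.norm_of_nonneg hmpos.le] at hfin
  linarith

theorem exists_subgradient [CompleteSpace E] {H : E → ℝ} (hH : Continuous H)
    (hconv : ConvexOn ℝ univ H) (p₀ : E) : ∃ q : E, ∀ p, H p₀ + ⟪q, p - p₀⟫ ≤ H p := by
  obtain ⟨f, hf⟩ := geometric_hahn_banach_point_open (x := (p₀, H p₀))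
    hconv.convex_strict_epigraph
    (by simpa using isOpen_lt (hH.comp continuous_fst) continuous_snd) (by simp)
  have hdec : ∀ p r, f (p, r) = f (p, 0) + r * f (0, 1) := fun p r => by
    rw [← smul_eq_mul, ← map_smul, ← map_add]
    simp
  have ha : 0 < f (0, 1) := by
    have h := hf (p₀, H p₀ + 1) (by simp)
    rw [hdec, hdec p₀ (H p₀ + 1)] at h
    linarith
  refine ⟨-(f (0, 1))⁻¹ •
    (InnerProductSpace.toDual ℝ E).symm (f.comp (ContinuousLinearMap.inl ℝ E ℝ)), fun p => ?_⟩
  rw [real_inner_smul_left, InnerProductSpace.toDual_symm_apply]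
  have hle : f (p₀, 0) + H p₀ * f (0, 1) ≤ f (p, 0) + H p * f (0, 1) := by
    refine le_of_forall_pos_le_add fun e he => ?_
    have h := hf (p, H p + e / f (0, 1)) (by simp; positivity)
    rw [hdec, hdec p, add_mul, div_mul_cancel₀ _ ha.ne'] at h
    linarith
  have hsub : f (p - p₀, 0) = f (p, 0) - f (p₀, 0) := by
    rw [← map_sub]; simp
  simp only [ContinuousLinearMap.comp_apply, ContinuousLinearMap.inl_apply, hsub]
  rw [← sub_nonneg]
  have : 0 ≤ (f (0, 1))⁻¹ * (f (p, 0) + H p * f (0, 1) - (f (p₀, 0) + H p₀ * f (0, 1))) :=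
    mul_nonneg (inv_nonneg.2 ha.le) (sub_nonneg.2 hle)
  field_simp at this ⊢
  linarith

/-- If `H` is not affine along `ξ` near the origin, then displacements of bounded cost, relative
to a subgradient `q₀` at the origin, have unbounded component along `ξ`. -/
theorem exists_large_displacement [CompleteSpace E] {H : E → ℝ} (hH : Continuous H)
    (hconv : ConvexOn ℝ univ H) (hH0 : H 0 = 0) {q₀ : E} (hq₀ : ∀ p, ⟪q₀, p⟫ ≤ H p) {ξ : E}
    (hξ : ∀ δ : ℝ, 0 < δ → ¬ ∃ α β : ℝ, ∀ s : ℝ, |s| < δ → H (s • ξ) = α * s + β)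
    {ε : ℝ} (hε : 0 < ε) (R : ℝ) :
    ∃ (t : ℝ) (q : E) (l : ℝ), 0 < t ∧ (∀ p, ⟪q, p⟫ - l ≤ H p) ∧ t * l ≤ ε ∧
      R ≤ |⟪ξ, t • (q - q₀)⟫| := by
  by_contra! hcon
  set M := |R| + 1
  have hM : 0 < M := by positivity
  refine hξ (ε / M) (by positivity) ⟨⟪q₀, ξ⟫, 0, fun s hs => ?_⟩
  have hlow := hq₀ (s • ξ)
  rw [real_inner_smul_right] at hlow
  refine le_antisymm ?_ (by linarith)
  obtain ⟨q, hq⟩ := exists_subgradient hH hconv (s • ξ)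
  set l := ⟪q, s • ξ⟫ - H (s • ξ) with hl
  have hmin : ∀ p, ⟪q, p⟫ - l ≤ H p := fun p => by
    have := hq p
    rw [inner_sub_right] at this
    linarith
  have hl0 : 0 ≤ l := by
    have := hmin 0
    rw [inner_zero_right, hH0] at this
    linarith
  set D := ⟪ξ, q - q₀⟫ with hD
  have hbd : ∀ t, 0 < t → t * l ≤ ε → t * |D| < M := fun t ht htl => by
    have h := hcon t q l ht hmin htl
    rw [real_inner_smul_right, abs_mul, abs_of_pos ht] at h
    linarith [le_abs_self R]
  have key : s * D ≤ l := by
    rcases hl0.eq_or_lt with h0 | hpos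
    · have hD0 : D = 0 := by
        by_contra hne
        have hDp : 0 < |D| := abs_pos.2 hne
        have := hbd (M / |D|) (by positivity) (by rw [← h0]; simpa using hε.le)
        rw [div_mul_cancel₀ _ hDp.ne'] at this
        exact lt_irrefl _ this
      rw [hD0, mul_zero]
      exact hl0
    · have h := hbd (ε / l) (by positivity) (by rw [div_mul_cancel₀ _ hpos.ne'])
      have h1 : ε * |D| < M * l := by
        rwa [div_mul_eq_mul_div, div_lt_iff₀ hpos] at h
      have h2 : |s| * M ≤ ε := by
        rw [lt_div_iff₀ hM] at hs
        exact hs.le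
      have h3 : s * D ≤ |s| * |D| := by rw [← abs_mul]; exact le_abs_self _
      have h4 : M * (|s| * |D|) ≤ M * l := by
        nlinarith [mul_le_mul_of_nonneg_right h2 (abs_nonneg D)]
      exact h3.trans (le_of_mul_le_mul_left h4 hM)
  rw [hD, inner_sub_right, real_inner_comm q, real_inner_comm q₀] at key
  rw [real_inner_smul_right] at hl
  linarith

/-- The test function used to compare viscosity solutions with explicit functions: it penalizes
times beyond `T` and the distance to the line `t ↦ y + t • q`. -/
def penalty (δ A T κ : ℝ) (y q : E) (p : ℝ × E) : ℝ :=
  δ * Real.exp (A * (p.1 - T)) + κ * ‖p.2 - (y + p.1 • q)‖ ^ 2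

theorem contDiff_penalty (δ A T κ : ℝ) (y q : E) : ContDiff ℝ 1 (penalty δ A T κ y q) := by
  unfold penalty
  have h : ContDiff ℝ 1 fun p : ℝ × E => p.2 - (y + p.1 • q) := by fun_prop
  exact (by fun_prop : ContDiff ℝ 1 fun p : ℝ × E => δ * Real.exp (A * (p.1 - T))).add
    (contDiff_const.mul (h.norm_sq ℝ))

theorem hasFDerivAt_penalty (δ A T κ : ℝ) (y q : E) (p : ℝ × E) :
    ∃ L : ℝ × E →L[ℝ] ℝ, HasFDerivAt (penalty δ A T κ y q) L p ∧
      L (1, 0) = δ * A * Real.exp (A * (p.1 - T)) - ⟪(2 * κ) • (p.2 - (y + p.1 • q)), q⟫ ∧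
      ∀ w : E, L (0, w) = ⟪(2 * κ) • (p.2 - (y + p.1 • q)), w⟫ := by
  have h1 : HasFDerivAt (fun p : ℝ × E => p.1) (ContinuousLinearMap.fst ℝ ℝ E) p := hasFDerivAt_fst
  have h2 : HasFDerivAt (fun p : ℝ × E => p.2) (ContinuousLinearMap.snd ℝ ℝ E) p := hasFDerivAt_snd
  have h3 := (((h1.sub_const T).const_mul A).exp).const_mul δ
  have h4 := ((h2.sub ((h1.smul_const q).const_add y)).norm_sq).const_mul κ
  refine ⟨_, h3.add h4, ?_, fun w => ?_⟩
  · simp [real_inner_smul_left, inner_sub_left, inner_add_left]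
    ring
  · simp [real_inner_smul_left, inner_sub_left, inner_add_left]
    ring

theorem exists_isMax_sub_penalty [FiniteDimensional ℝ E] {w : ℝ × E → ℝ}
    (hw : ContinuousOn w (Ici (0 : ℝ) ×ˢ univ)) {T M δ A κ : ℝ} (hT : 0 < T)
    (hM : ∀ t, 0 ≤ t → t ≤ T + 1 → ∀ x, |w (t, x)| ≤ M) (hδ : 0 < δ) (hA : 2 * M + 1 ≤ δ * A)
    (hκ : 0 < κ) (y q : E) :
    ∃ t x, 0 ≤ t ∧ t < T + 1 ∧ ∀ t', 0 ≤ t' → t' ≤ T + 1 → ∀ x',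
      w (t', x') - penalty δ A T κ y q (t', x') ≤ w (t, x) - penalty δ A T κ y q (t, x) := by
  set f : ℝ × E → ℝ := fun p => w p - penalty δ A T κ y q p with hf
  have hfc : ContinuousOn f (Icc 0 (T + 1) ×ˢ univ) :=
    (hw.mono (prod_mono Icc_subset_Ici_self subset_rfl)).sub
      (contDiff_penalty δ A T κ y q).continuous.continuousOn
  have hbase : -M - δ ≤ f (T, y + T • q) := by
    have := (abs_le.1 (hM T hT.le (by linarith) (y + T • q))).1
    simp only [hf, penalty, sub_self, mul_zero, Real.exp_zero, norm_zero]
    linarith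
  have hM0 : 0 ≤ M := (abs_nonneg _).trans (hM T hT.le (by linarith) y)
  set ρ := Real.sqrt ((2 * M + δ) / κ) with hρ
  set r := (T + 1) * ‖q‖ + ρ with hr
  obtain ⟨⟨t, x⟩, hmem, hmax⟩ := hfc.exists_isMaxOn' (isClosed_Icc.prod isClosed_univ)
    (x₀ := (T, y + T • q)) ⟨⟨hT.le, by linarith⟩, trivial⟩ (by
      have hK : (Icc 0 (T + 1) ×ˢ Metric.closedBall y r : Set (ℝ × E))ᶜ ∈ cocompact (ℝ × E) :=
        (isCompact_Icc.prod (isCompact_closedBall y r)).compl_mem_cocompact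
      filter_upwards [mem_inf_of_left hK, mem_inf_of_right (mem_principal_self _)]
        with ⟨t, x⟩ h1 h2
      refine le_trans ?_ hbase
      have ht : t ∈ Icc 0 (T + 1) := h2.1
      have hx : r < ‖x - y‖ := by
        by_contra! hle
        exact h1 ⟨ht, by simpa [dist_eq_norm] using hle⟩
      have htq : ‖t • q‖ ≤ (T + 1) * ‖q‖ := by
        rw [norm_smul, Real.norm_of_nonneg ht.1]
        exact mul_le_mul_of_nonneg_right ht.2 (norm_nonneg _)
      have hρx : ρ ≤ ‖x - (y + t • q)‖ := by
        have := norm_sub_norm_le (x - y) (t • q)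
        rw [sub_sub] at this
        linarith
      have hsq : (2 * M + δ) / κ ≤ ‖x - (y + t • q)‖ ^ 2 := by
        rw [← Real.sq_sqrt (by positivity : 0 ≤ (2 * M + δ) / κ)]
        exact pow_le_pow_left₀ (Real.sqrt_nonneg _) hρx 2
      rw [div_le_iff₀ hκ] at hsq
      have hwM := (abs_le.1 (hM t ht.1 ht.2 x)).2
      have hexp : 0 < δ * Real.exp (A * (t - T)) := by positivity
      simp only [hf, penalty]
      linarith)
  refine ⟨t, x, hmem.1.1, lt_of_le_of_ne hmem.1.2 ?_, fun t' h0 h1 x' => hmax ⟨⟨h0, h1⟩, trivial⟩⟩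
  intro htT
  have h1 : f (T, y + T • q) ≤ f (t, x) := hmax ⟨⟨hT.le, by linarith⟩, trivial⟩
  have h2 := (abs_le.1 (hM t hmem.1.1 hmem.1.2 x)).2
  have h3 : f (t, x) ≤ M - δ * (A + 1) := by
    have he : A + 1 ≤ Real.exp (A * (t - T)) := by
      rw [htT, add_sub_cancel_left, mul_one]
      exact Real.add_one_le_exp A
    have := mul_le_mul_of_nonneg_left he hδ.le
    have h4 : 0 ≤ κ * ‖x - (y + t • q)‖ ^ 2 := by positivity
    simp only [hf, penalty]
    linarith
  linarith

theorem IsBUCloc.exists_bound {F : Type*} [NormedAddCommGroup F] {u : ℝ × F → ℝ}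
    (hu : IsBUCloc u) {T : ℝ} (hT : 0 < T) :
    ∃ M, 0 ≤ M ∧ ∀ t, 0 ≤ t → t ≤ T → ∀ x, |u (t, x)| ≤ M := by
  obtain ⟨M, hM⟩ := (hu.2 (T + 1) (by linarith)).1
  refine ⟨M, (abs_nonneg _).trans (hM (0, 0) ⟨⟨le_rfl, by linarith⟩, trivial⟩),
    fun t h0 h1 x => hM (t, x) ⟨⟨h0, by linarith⟩, trivial⟩⟩

theorem Ioo_prod_univ_mem_nhds {F : Type*} [TopologicalSpace F] {a b t : ℝ} (ha : a < t)
    (hb : t < b) (x : F) : Ioo a b ×ˢ (univ : Set F) ∈ 𝓝 (t, x) :=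
  prod_mem_nhds (Ioo_mem_nhds ha hb) univ_mem

/-- Upper bound along a straight line, from an affine minorant of the Hamiltonian. -/
theorem IsViscSubsol.le_transport [FiniteDimensional ℝ E] {H u₀ : E → ℝ} {u : ℝ × E → ℝ}
    (hu : IsViscSubsol H u₀ u) (hu₀ : Continuous u₀) {q : E} {l : ℝ} (hl : 0 ≤ l)
    (hq : ∀ p, ⟪q, p⟫ - l ≤ H p) {T : ℝ} (hT : 0 < T) (y : E) :
    u (T, y + T • q) ≤ u₀ y + T * l := by
  by_contra! hlt
  obtain ⟨M, hM0, hM⟩ := hu.1.exists_bound (by linarith : 0 < T + 1)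
  set δ := (u (T, y + T • q) - (u₀ y + T * l)) / 4 with hδdef
  have hδ : 0 < δ := by linarith
  obtain ⟨η, hη, hclose⟩ := Metric.continuousAt_iff.1 hu₀.continuousAt δ hδ
  set κ := 2 * M / η ^ 2 + 1 with hκdef
  have hκ : 0 < κ := by positivity
  have hinit : ∀ x, u (0, x) - κ * ‖x - y‖ ^ 2 ≤ u₀ y + δ := by
    intro x
    have hnn : 0 ≤ κ * ‖x - y‖ ^ 2 := by positivity
    rcases lt_or_ge ‖x - y‖ η with hx | hx
    · have h1 := hclose (by rwa [dist_eq_norm] : dist x y < η)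
      rw [Real.dist_eq] at h1
      linarith [hu.2.1 x, (abs_lt.1 h1).2]
    · have h1 : 2 * M ≤ κ * ‖x - y‖ ^ 2 := by
        calc 2 * M = 2 * M / η ^ 2 * η ^ 2 := by field_simp
          _ ≤ κ * ‖x - y‖ ^ 2 := by
            refine mul_le_mul (by linarith) (pow_le_pow_left₀ hη.le hx 2) (by positivity) hκ.le
      have h2 := (abs_le.1 (hM 0 le_rfl (by linarith) x)).2
      have h3 := (abs_le.1 (hM 0 le_rfl (by linarith) y)).1
      linarith [hu.2.1 y]
  set M' := M + (T + 1) * l with hM'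
  have hM'0 : 0 ≤ M' := by positivity
  set A := (2 * M' + 1) / δ with hAdef
  have hA : 0 < A := by positivity
  obtain ⟨t, x, ht0, ht1, hmax⟩ := exists_isMax_sub_penalty (w := fun p => u p - l * p.1)
    (hu.1.1.sub (by fun_prop)) (M := M') hT (fun t h0 h1 x => by
      have h2 : |l * t| ≤ (T + 1) * l := by
        rw [abs_of_nonneg (by positivity), mul_comm]
        exact mul_le_mul_of_nonneg_right h1 hl
      exact (abs_sub _ _).trans (add_le_add (hM t h0 h1 x) h2)) hδ
    (A := A) (by rw [hAdef, mul_div_cancel₀ _ hδ.ne']) hκ y q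
  have hbase := hmax T hT.le (by linarith) (y + T • q)
  simp only [penalty, sub_self, mul_zero, Real.exp_zero, norm_zero] at hbase
  rcases ht0.eq_or_lt with rfl | htpos
  · have h1 := hinit x
    have h2 : 0 < δ * Real.exp (A * (0 - T)) := by positivity
    rw [zero_smul, add_zero] at hbase
    linarith
  · obtain ⟨L, hL, hLt, hLx⟩ := hasFDerivAt_penalty δ A T κ y q (t, x)
    set v := (2 * κ) • (x - (y + t • q)) with hv
    have hder : HasFDerivAt (fun p : ℝ × E => l * p.1 + penalty δ A T κ y q p)
        (l • ContinuousLinearMap.fst ℝ ℝ E + L) (t, x) :=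
      (hasFDerivAt_fst.const_mul l).add hL
    have hsol := hu.2.2 (t, x) ⟨htpos, trivial⟩
      (l + (δ * A * Real.exp (A * (t - T)) - ⟪v, q⟫), v)
      ⟨fun p => l * p.1 + penalty δ A T κ y q p,
        (by fun_prop : ContDiff ℝ 1 fun p : ℝ × E => l * p.1).add (contDiff_penalty ..), ?_, ?_, ?_⟩
    · have h1 := hq v
      have h2 : 0 < δ * A * Real.exp (A * (t - T)) := by positivity
      rw [real_inner_comm] at h1
      simp only at hsol
      linarith
    · refine IsLocalMax.on ?_ _
      filter_upwards [Ioo_prod_univ_mem_nhds htpos ht1 x] with ⟨t', x'⟩ ht'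
      have := hmax t' ht'.1.1.le ht'.1.2.le x'
      simp only at this ⊢
      linarith
    · rw [hder.fderiv]
      simp [hLt, hv]
    · intro w
      rw [hder.fderiv]
      simp [hLx, hv]

/-- Constants below the initial datum stay below a supersolution. -/
theorem IsViscSupersol.const_le [FiniteDimensional ℝ E] {H u₀ : E → ℝ} {u : ℝ × E → ℝ}
    (hu : IsViscSupersol H u₀ u) (hH : Continuous H) (hH0 : H 0 = 0) {c : ℝ}
    (hc : ∀ x, c ≤ u₀ x) {T : ℝ} (hT : 0 < T) (y : E) : c ≤ u (T, y) := by
  by_contra! hlt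
  obtain ⟨M, hM0, hM⟩ := hu.1.exists_bound (by linarith : 0 < T + 1)
  set δ := (c - u (T, y)) / 2 with hδdef
  have hδ : 0 < δ := by linarith
  set A := (2 * M + 1) / δ with hAdef
  have hA : 0 < A := by positivity
  obtain ⟨η, hη, hclose⟩ := Metric.continuousAt_iff.1 (hH.continuousAt (x := 0))
    (δ * A * Real.exp (A * (0 - T))) (by positivity)
  set κ := η ^ 2 / (8 * (2 * M + δ)) with hκdef
  have hκ : 0 < κ := by positivity
  obtain ⟨t, x, ht0, ht1, hmax⟩ := exists_isMax_sub_penalty (w := fun p => -u p)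
    hu.1.1.neg (M := M) hT (fun t h0 h1 x => by simpa using hM t h0 h1 x) hδ
    (A := A) (by rw [hAdef, mul_div_cancel₀ _ hδ.ne']) hκ y 0
  have hbase := hmax T hT.le (by linarith) y
  simp only [penalty, sub_self, mul_zero, Real.exp_zero, norm_zero, smul_zero, add_zero] at hbase
  have hsqnn : 0 ≤ κ * ‖x - y‖ ^ 2 := by positivity
  have hexp : 0 < δ * Real.exp (A * (t - T)) := by positivity
  rcases ht0.eq_or_lt with rfl | htpos
  · linarith [hu.2.1 x, hc x]
  · obtain ⟨L, hL, hLt, hLx⟩ := hasFDerivAt_penalty δ A T κ y 0 (t, x)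
    set v := (2 * κ) • (x - y) with hv
    have hvη : ‖v‖ < η := by
      have h1 := (abs_le.1 (hM t ht0 ht1.le x)).1
      have h2 := (abs_le.1 (hM T hT.le (by linarith) y)).2
      have h3 : κ * ‖x - y‖ ^ 2 ≤ 2 * M + δ := by linarith
      have h4 : ‖v‖ ^ 2 ≤ η ^ 2 / 2 := by
        rw [hv, norm_smul, Real.norm_of_nonneg (by positivity)]
        calc (2 * κ * ‖x - y‖) ^ 2 = 4 * κ * (κ * ‖x - y‖ ^ 2) := by ring
          _ ≤ 4 * κ * (2 * M + δ) := by gcongr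
          _ = η ^ 2 / 2 := by rw [hκdef]; field_simp; norm_num
      refine lt_of_pow_lt_pow_left₀ 2 hη.le ?_
      have : 0 < η ^ 2 := by positivity
      linarith
    have hsol := hu.2.2 (t, x) ⟨htpos, trivial⟩
      (-(δ * A * Real.exp (A * (t - T))), -v)
      ⟨fun p => -penalty δ A T κ y 0 p, (contDiff_penalty ..).neg, ?_, ?_, ?_⟩
    · have h1 := hclose (by simpa using hvη : dist (-v) 0 < η)
      rw [hH0, Real.dist_eq, sub_zero] at h1
      have h2 : Real.exp (A * (0 - T)) ≤ Real.exp (A * (t - T)) := by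
        refine Real.exp_le_exp.2 (mul_le_mul_of_nonneg_left ?_ hA.le)
        linarith
      have h3 := mul_le_mul_of_nonneg_left h2 (by positivity : 0 ≤ δ * A)
      simp only at hsol
      linarith [(abs_lt.1 h1).2]
    · refine IsLocalMin.on ?_ _
      filter_upwards [Ioo_prod_univ_mem_nhds htpos ht1 x] with ⟨t', x'⟩ ht'
      have := hmax t' ht'.1.1.le ht'.1.2.le x'
      simp only [sub_neg_eq_add]
      linarith
    · rw [hL.fun_neg.fderiv]
      simp [hLt]
    · intro w
      rw [hL.fun_neg.fderiv]
      simp [hLx, hv]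

/-- **Periodic case without coercivity** (Theorem 2 and Remark 1): if `H` is convex, `H(0) = 0`,
and for every nonzero `ξ ∈ ℤⁿ` the map `s ↦ H(sξ)` is not affine near `0`, then the viscosity
solution with continuous `ℤⁿ`-periodic datum `u₀` decays uniformly to `c = min u₀`. -/
theorem decay_periodic {n : ℕ} (H : EuclideanSpace ℝ (Fin n) → ℝ) (hH : Continuous H)
    (hconv : ConvexOn ℝ Set.univ H) (hH0 : H 0 = 0)
    (hND : ∀ ξ : EuclideanSpace ℝ (Fin n), (∀ i, ∃ k : ℤ, ξ i = (k : ℝ)) → ξ ≠ 0 →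
      ∀ δ : ℝ, 0 < δ → ¬ ∃ α β : ℝ, ∀ s : ℝ, |s| < δ → H (s • ξ) = α * s + β)
    (u₀ : EuclideanSpace ℝ (Fin n) → ℝ) (h₀cont : Continuous u₀)
    (h₀per : ∀ x : EuclideanSpace ℝ (Fin n), ∀ e : Fin n → ℤ,
      u₀ (x + (EuclideanSpace.equiv (Fin n) ℝ).symm (fun i => (e i : ℝ))) = u₀ x)
    (u : ℝ × EuclideanSpace ℝ (Fin n) → ℝ) (hu : IsViscSol H u₀ u) :
    ∀ ε : ℝ, 0 < ε → ∃ T : ℝ, ∀ t ≥ T, ∀ x : EuclideanSpace ℝ (Fin n),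
      |u (t, x) - sInf (Set.range u₀)| ≤ ε := by
  intro ε hε
  obtain ⟨g, hg⟩ := exists_torus_lift h₀cont h₀per
  obtain ⟨y₀, -, hmin₀⟩ := isCompact_univ.exists_isMinOn univ_nonempty g.continuous.continuousOn
  have hy₀ : ∀ y, g y₀ ≤ g y := fun y => hmin₀ (mem_univ y)
  obtain ⟨x₀, hx₀⟩ := (isOpenQuotientMap_torusProj n).surjective y₀
  have hleast : IsLeast (range u₀) (g y₀) :=
    ⟨⟨x₀, by rw [← hg, hx₀]⟩, by rintro _ ⟨x, rfl⟩; rw [← hg]; exact hy₀ _⟩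
  rw [hleast.csInf_eq]
  set c := g y₀ with hc
  obtain ⟨q₀, hq₀⟩ := exists_subgradient hH hconv 0
  simp only [hH0, sub_zero, zero_add] at hq₀
  obtain ⟨S, R, hS0, hS⟩ := exists_pos_on_box (⟨fun y => max 0 (c + ε / 2 - g y), by fun_prop⟩)
    (fun y => le_max_left _ _) (y₀ := y₀) (by
      have : c + ε / 2 - g y₀ = ε / 2 := by rw [hc]; ring
      simp only [ContinuousMap.coe_mk, this]
      exact (lt_max_of_lt_right (by positivity)).ne')
  set N : ℝ := S.card + 1 with hN
  have hNpos : 0 < N := by positivity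
  have hdisp : ∀ ξ : S, ∃ (t : ℝ) (q : EuclideanSpace ℝ (Fin n)) (l : ℝ), 0 < t ∧
      (∀ p, ⟪q, p⟫ - l ≤ H p) ∧ t * l ≤ ε / 2 ∧
      N * R ≤ |⟪WithLp.toLp 2 fun i => (ξ.1 i : ℝ), t • (q - q₀)⟫| := by
    intro ξ
    refine exists_large_displacement hH hconv hH0 hq₀
      (hND _ (fun i => ⟨ξ.1 i, rfl⟩) fun h => ?_) (by positivity) _
    refine hS0 ?_
    have h0 : ξ.1 = 0 := by
      ext i
      have := congrArg (fun v : EuclideanSpace ℝ (Fin n) => v i) h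
      simpa using this
    rw [← h0]
    exact ξ.2
  choose τ q l hτ hmin hcost hbig using hdisp
  have hl0 : ∀ ξ, 0 ≤ l ξ := fun ξ => by
    have := hmin ξ 0
    rw [inner_zero_right, hH0] at this
    linarith
  have hcard : ∑ _ξ : S, (1 : ℝ) ≤ N := by simp [hN]
  refine ⟨1 + ∑ ξ, τ ξ, fun t ht x => ?_⟩
  have hτsum : 0 ≤ ∑ ξ, τ ξ := Finset.sum_nonneg fun ξ _ => (hτ ξ).le
  have htpos : 0 < t := by linarith
  have hlow := hu.2.const_le hH hH0 (fun x => hleast.2 ⟨x, rfl⟩) htpos x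
  obtain ⟨s, hs, hpos⟩ := hS (fun ξ => N⁻¹ • τ ξ • (q ξ - q₀)) (fun ξ => by
    have h := hbig ξ
    rw [PiLp.inner_apply] at h
    have h2 : ∑ i, ξ.1 i * (N⁻¹ • τ ξ • (q ξ - q₀)) i = N⁻¹ *
        ∑ i, inner ℝ ((WithLp.toLp 2 fun i => (ξ.1 i : ℝ)) i : ℝ) ((τ ξ • (q ξ - q₀)) i) := by
      rw [Finset.mul_sum]
      refine Finset.sum_congr rfl fun i _ => ?_
      simp
      ring
    rw [h2, abs_mul, abs_of_pos (inv_pos.2 hNpos), ← div_eq_inv_mul, le_div_iff₀ hNpos]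
    linarith) (x - t • q₀)
  set y := x - t • q₀ - ∑ ξ, s ξ • N⁻¹ • τ ξ • (q ξ - q₀) with hy
  have huy : u₀ y < c + ε / 2 := by
    rw [← hg]
    rcases lt_max_iff.1 hpos with h | h
    · exact absurd h (lt_irrefl _)
    · linarith
  set w : S → ℝ := fun ξ => s ξ * N⁻¹ * τ ξ / t with hw
  have hw0 : ∀ ξ, 0 ≤ w ξ := fun ξ =>
    div_nonneg (mul_nonneg (mul_nonneg (hs ξ).1 (inv_nonneg.2 hNpos.le)) (hτ ξ).le) htpos.le
  have htw : ∀ ξ, t * w ξ = s ξ * N⁻¹ * τ ξ := fun ξ => mul_div_cancel₀ _ htpos.ne'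
  have hsN : ∀ ξ, s ξ * N⁻¹ ≤ N⁻¹ := fun ξ =>
    mul_le_of_le_one_left (inv_nonneg.2 hNpos.le) (hs ξ).2
  have hwsum : ∑ ξ, w ξ ≤ 1 := by
    have h1 : ∀ ξ ∈ Finset.univ, w ξ ≤ N⁻¹ * 1 := fun ξ hξ => by
      rw [hw, div_le_iff₀ htpos, mul_one]
      have : τ ξ ≤ t := by
        have := Finset.single_le_sum (fun ξ _ => (hτ ξ).le) hξ
        linarith
      exact mul_le_mul (hsN ξ) this (hτ ξ).le (inv_nonneg.2 hNpos.le)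
    refine (Finset.sum_le_sum h1).trans ?_
    rw [← Finset.mul_sum, inv_mul_le_iff₀ hNpos]
    linarith
  have hminw : ∀ p, ⟪q₀ + ∑ ξ, w ξ • (q ξ - q₀), p⟫ - ∑ ξ, w ξ * l ξ ≤ H p := fun p => by
    have h1 : ⟪q₀ + ∑ ξ, w ξ • (q ξ - q₀), p⟫ - ∑ ξ, w ξ * l ξ =
        (1 - ∑ ξ, w ξ) * ⟪q₀, p⟫ + ∑ ξ, w ξ * (⟪q ξ, p⟫ - l ξ) := by
      simp only [inner_add_left, sum_inner, real_inner_smul_left, inner_sub_left, mul_sub,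
        Finset.sum_sub_distrib, sub_mul, Finset.sum_mul, one_mul]
      ring
    have h2 : ∑ ξ, w ξ * (⟪q ξ, p⟫ - l ξ) ≤ (∑ ξ, w ξ) * H p := by
      rw [Finset.sum_mul]
      exact Finset.sum_le_sum fun ξ _ => mul_le_mul_of_nonneg_left (hmin ξ p) (hw0 ξ)
    have h3 := mul_le_mul_of_nonneg_left (hq₀ p) (sub_nonneg.2 hwsum)
    rw [h1]
    linarith
  have hup := hu.1.le_transport h₀cont
    (Finset.sum_nonneg fun ξ _ => mul_nonneg (hw0 ξ) (hl0 ξ)) hminw htpos y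
  have hxy : y + t • (q₀ + ∑ ξ, w ξ • (q ξ - q₀)) = x := by
    rw [hy, smul_add, Finset.smul_sum]
    simp only [smul_smul, htw, mul_assoc]
    abel
  have htl : t * ∑ ξ, w ξ * l ξ ≤ ε / 2 := by
    have h1 : ∀ ξ ∈ Finset.univ, t * (w ξ * l ξ) ≤ N⁻¹ * (ε / 2) * 1 := fun ξ _ => by
      rw [← mul_assoc, htw, mul_one, mul_assoc]
      exact mul_le_mul (hsN ξ) (hcost ξ) (mul_nonneg (hτ ξ).le (hl0 ξ)) (inv_nonneg.2 hNpos.le)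
    rw [Finset.mul_sum]
    refine (Finset.sum_le_sum h1).trans ?_
    rw [← Finset.mul_sum, mul_assoc, inv_mul_le_iff₀ hNpos, mul_comm]
    exact mul_le_mul_of_nonneg_right hcard (by positivity)
  rw [hxy] at hup
  rw [abs_of_nonneg (sub_nonneg.2 hlow)]
  linarith
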